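/- Let 0 < a < b < ∞ and let ϱ : [a,b] → ℝ be a non-negative, non-decreasing, bounded function. Then: (i) there exists a pair (w, λ) with w : [a,b] → ℝ Lipschitz and λ ∈ ℝ such that w'(x) + λ·w(x)² = (1/x + ϱ(x))·w(x) for a.e. x ∈ (a,b) and w(a) = w(b) = 1; (ii) this pair is unique; (iii) λ = m := (g(b) − g(a))/∫_a^b g(t) dt, where g(x) := x·e^{h(x)} and h is a primitive of ϱ. -/

import Mathlib

open MeasureTheory Set Filter

/-- A pair `(w, lam)` solves the Riccati boundary value problem (9.6):
`w` is Lipschitz on `[a,b]`, `w' + lam·w² = (1/x + ρ x)·w` a.e. on `(a,b)` and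
`w a = w b = 1`. -/
def IsRiccatiSol (a b lam : ℝ) (ρ w : ℝ → ℝ) : Prop :=
  (∃ K : NNReal, LipschitzOnWith K w (Set.Icc a b)) ∧
    (∀ᵐ x ∂MeasureTheory.volume,
      x ∈ Set.Ioo a b → HasDerivAt w ((1 / x + ρ x) * w x - lam * w x ^ 2) x) ∧
    w a = 1 ∧ w b = 1

theorem LipschitzOnWith.exists_comp_of_contDiffAt {E F : Type*}
    [NormedAddCommGroup E] [NormedSpace ℝ E] [NormedAddCommGroup F] [NormedSpace ℝ F]
    {s : Set ℝ} (hs : IsCompact s) {K : NNReal} {f : ℝ → E} {φ : E → F}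
    (hf : LipschitzOnWith K f s) (hφ : ∀ x ∈ s, ContDiffAt ℝ 1 φ (f x)) :
    ∃ L, LipschitzOnWith L (fun x => φ (f x)) s := by
  have hloc : LocallyLipschitzOn (f '' s) φ := by
    rintro _ ⟨x, hx, rfl⟩
    obtain ⟨L, t, ht, hL⟩ := (hφ x hx).exists_lipschitzOnWith
    exact ⟨L, t, mem_nhdsWithin_of_mem_nhds ht, hL⟩
  obtain ⟨L, hL⟩ := hloc.exists_lipschitzOnWith_of_compact
    (hs.image_of_continuousOn hf.continuousOn)
  exact ⟨_, hL.comp hf (mapsTo_image f s)⟩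

theorem exists_lipschitzOnWith_integral {a b C : ℝ} {f : ℝ → ℝ}
    (hf : IntervalIntegrable f volume a b) (hC : ∀ x ∈ Icc a b, ‖f x‖ ≤ C) :
    ∃ K, LipschitzOnWith K (fun x => ∫ t in a..x, f t) (Icc a b) := by
  refine ⟨C.toNNReal, LipschitzOnWith.of_dist_le_mul fun x hx y hy => ?_⟩
  have hab : a ≤ b := hx.1.trans hx.2
  have hsub : ∀ z ∈ Icc a b, IntervalIntegrable f volume a z := fun z hz =>
    hf.mono_set (by rw [uIcc_of_le hab, uIcc_of_le hz.1]; exact Icc_subset_Icc_right hz.2)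
  rw [dist_eq_norm, intervalIntegral.integral_interval_sub_left (hsub x hx) (hsub y hy),
    Real.dist_eq]
  refine intervalIntegral.norm_integral_le_of_norm_le_const fun t ht => ?_
  refine (hC t ?_).trans (Real.le_coe_toNNReal C)
  exact (convex_Icc a b).ordConnected.uIcc_subset hy hx (uIoc_subset_uIcc ht)

theorem ContinuousOn.exists_lipschitzOnWith_integral {a b : ℝ} (hab : a ≤ b) {f : ℝ → ℝ}
    (hf : ContinuousOn f (Icc a b)) :
    ∃ K, LipschitzOnWith K (fun x => ∫ t in a..x, f t) (Icc a b) := by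
  obtain ⟨C, hC⟩ := isCompact_Icc.exists_bound_of_continuousOn hf
  exact _root_.exists_lipschitzOnWith_integral (hf.intervalIntegrable_of_Icc hab) hC

theorem IntervalIntegrable.ae_hasDerivAt_integral_left {a b : ℝ} (hab : a ≤ b) {f : ℝ → ℝ}
    (hf : IntervalIntegrable f volume a b) :
    ∀ᵐ x, x ∈ Ioo a b → HasDerivAt (fun x => ∫ t in a..x, f t) (f x) x := by
  filter_upwards [hf.ae_hasDerivAt_integral] with x hx hx'
  rw [uIcc_of_le hab] at hx
  exact hx (Ioo_subset_Icc_self hx') a (left_mem_Icc.2 hab)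

theorem LipschitzOnWith.eq_left_of_ae_hasDerivAt_zero {a b : ℝ} {K : NNReal} {f : ℝ → ℝ}
    (hf : LipschitzOnWith K f (Icc a b)) (hd : ∀ᵐ x, x ∈ Ioo a b → HasDerivAt f 0 x) :
    ∀ x ∈ Icc a b, f x = f a := by
  intro x hx
  have hab : a ≤ b := hx.1.trans hx.2
  rw [← uIcc_of_le hab] at hf hx
  have hd' : ∀ᵐ x, x ∈ uIcc a b → HasDerivAt f 0 x := by
    filter_upwards [hd, Measure.ae_ne volume a, Measure.ae_ne volume b] with y hy hya hyb hyI
    rw [uIcc_of_le hab] at hyI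
    exact hy ⟨lt_of_le_of_ne hyI.1 hya.symm, lt_of_le_of_ne hyI.2 hyb⟩
  obtain ⟨c, hc⟩ := hf.absolutelyContinuousOnInterval.const_of_ae_hasDerivAt_zero hd'
  rw [hc x hx, hc a left_mem_uIcc]

/-- A solution of the Riccati equation `w' + lam·w² = q·w` is determined by a positive solution `g`
of the linear equation `g' = q·g`. -/
theorem riccati_mul_eq {a b lam : ℝ} (hab : a ≤ b) {q g w : ℝ → ℝ} {Kg Kw : NNReal}
    (hgL : LipschitzOnWith Kg g (Icc a b)) (hg0 : ∀ x ∈ Icc a b, 0 < g x)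
    (hg : ∀ᵐ x, x ∈ Ioo a b → HasDerivAt g (q x * g x) x)
    (hwL : LipschitzOnWith Kw w (Icc a b))
    (hw : ∀ᵐ x, x ∈ Ioo a b → HasDerivAt w (q x * w x - lam * w x ^ 2) x) (hwa : w a = 1) :
    ∀ x ∈ Icc a b, w x * (g a + lam * ∫ t in a..x, g t) = g x := by
  have hga := hg0 a (left_mem_Icc.2 hab)
  obtain ⟨KW, hWL⟩ := hwL.continuousOn.exists_lipschitzOnWith_integral hab
  obtain ⟨KG, hGL⟩ := hgL.continuousOn.exists_lipschitzOnWith_integral hab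
  have hW := (hwL.continuousOn.intervalIntegrable_of_Icc hab).ae_hasDerivAt_integral_left hab
  have hG := (hgL.continuousOn.intervalIntegrable_of_Icc hab).ae_hasDerivAt_integral_left hab
  set W : ℝ → ℝ := fun x => ∫ t in a..x, w t with hWdef
  set G : ℝ → ℝ := fun x => ∫ t in a..x, g t with hGdef
  have hWa : W a = 0 := by simp [hWdef]
  have hGa : G a = 0 := by simp [hGdef]
  have hquot : ∀ x ∈ Icc a b, w x * Real.exp (lam * W x) / g x = 1 / g a := by
    obtain ⟨L, hL⟩ := ((hwL.prodMk hWL).prodMk hgL).exists_comp_of_contDiffAt isCompact_Icc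
      (φ := fun p : (ℝ × ℝ) × ℝ => p.1.1 * Real.exp (lam * p.1.2) / p.2) fun x hx => by
        have := (hg0 x hx).ne'
        fun_prop (disch := assumption)
    intro x hx
    have h := hL.eq_left_of_ae_hasDerivAt_zero (by
      filter_upwards [hg, hw, hW] with y hgy hwy hWy hy
      have hpos := hg0 y (Ioo_subset_Icc_self hy)
      refine (((hwy hy).mul ((hWy hy).const_mul lam).exp).div (hgy hy) hpos.ne').congr_deriv ?_
      rw [div_eq_zero_iff]
      left
      simp only [Pi.mul_apply]
      ring) x hx
    simpa [hwa, hWa] using h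
  have hexp : ∀ x ∈ Icc a b, Real.exp (lam * W x) - lam / g a * G x = 1 := by
    obtain ⟨L, hL⟩ := (hWL.prodMk hGL).exists_comp_of_contDiffAt isCompact_Icc
      (φ := fun p : ℝ × ℝ => Real.exp (lam * p.1) - lam / g a * p.2) fun x hx => by fun_prop
    intro x hx
    have h := hL.eq_left_of_ae_hasDerivAt_zero (by
      filter_upwards [hW, hG] with y hWy hGy hy
      have hpos := hg0 y (Ioo_subset_Icc_self hy)
      have hq := hquot y (Ioo_subset_Icc_self hy)
      refine (((hWy hy).const_mul lam).exp.sub ((hGy hy).const_mul (lam / g a))).congr_deriv ?_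
      field_simp at hq ⊢
      linear_combination lam * hq) x hx
    simpa [hWa, hGa] using h
  intro x hx
  have hq := hquot x hx
  have he := hexp x hx
  have hpos := hg0 x hx
  change w x * (g a + lam * G x) = g x
  rw [sub_eq_iff_eq_add.1 he] at hq
  field_simp at hq
  linear_combination hq

/-- Conversely, a positive solution `g` of `g' = q·g` yields a Lipschitz solution of
`w' + m·w² = q·w`. -/
theorem riccati_div_solves {a b m : ℝ} (hab : a ≤ b) {q g : ℝ → ℝ} {Kg : NNReal}
    (hgL : LipschitzOnWith Kg g (Icc a b))
    (hg : ∀ᵐ x, x ∈ Ioo a b → HasDerivAt g (q x * g x) x)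
    (hD : ∀ x ∈ Icc a b, 0 < g a + m * ∫ t in a..x, g t) :
    (∃ K, LipschitzOnWith K (fun x => g x / (g a + m * ∫ t in a..x, g t)) (Icc a b)) ∧
      ∀ᵐ x, x ∈ Ioo a b → HasDerivAt (fun x => g x / (g a + m * ∫ t in a..x, g t))
        (q x * (g x / (g a + m * ∫ t in a..x, g t))
          - m * (g x / (g a + m * ∫ t in a..x, g t)) ^ 2) x := by
  obtain ⟨KG, hGL⟩ := hgL.continuousOn.exists_lipschitzOnWith_integral hab
  constructor
  · exact (hgL.prodMk hGL).exists_comp_of_contDiffAt isCompact_Icc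
      (φ := fun p : ℝ × ℝ => p.1 / (g a + m * p.2)) fun x hx => by
        have := (hD x hx).ne'
        fun_prop (disch := assumption)
  · filter_upwards [hg,
      (hgL.continuousOn.intervalIntegrable_of_Icc hab).ae_hasDerivAt_integral_left hab]
      with x hgx hGx hx
    have hpos := (hD x (Ioo_subset_Icc_self hx)).ne'
    refine ((hgx hx).div (((hGx hx).const_mul m).const_add (g a)) hpos).congr_deriv ?_
    field_simp

/-- **Lemma 9.8.** Let `0 < a < b < ∞`, `ρ` non-negative non-decreasing bounded on
`[a,b]`, `h` a primitive of `ρ` and `g x = x e^{h x}`.  Then (i) the Riccati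
boundary value problem (9.6) has a solution `(w, lam)`; (ii) it is unique;
(iii) `lam = m = (g b − g a)/∫_a^b g`. -/
theorem riccati_bvp_existence_uniqueness
    (a b : ℝ) (ha : 0 < a) (hab : a < b)
    (ρ h g : ℝ → ℝ)
    (hρ0 : ∀ x ∈ Set.Icc a b, 0 ≤ ρ x)
    (hρmono : MonotoneOn ρ (Set.Icc a b))
    (hρbdd : ∃ C, ∀ x ∈ Set.Icc a b, ρ x ≤ C)
    (hprim : ∀ x ∈ Set.Icc a b, h x = h a + ∫ t in a..x, ρ t)
    (hg : ∀ x ∈ Set.Icc a b, g x = x * Real.exp (h x)) :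
    (∃ w lam, IsRiccatiSol a b lam ρ w) ∧
    (∀ w₁ lam₁ w₂ lam₂, IsRiccatiSol a b lam₁ ρ w₁ → IsRiccatiSol a b lam₂ ρ w₂ →
        lam₁ = lam₂ ∧ ∀ x ∈ Set.Icc a b, w₁ x = w₂ x) ∧
    (∀ w lam, IsRiccatiSol a b lam ρ w →
        lam = (g b - g a) / ∫ t in a..b, g t) := by
  have hle := hab.le
  have haI : a ∈ Icc a b := left_mem_Icc.2 hle
  have hbI : b ∈ Icc a b := right_mem_Icc.2 hle
  obtain ⟨C, hC⟩ := hρbdd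
  have hρint : IntervalIntegrable ρ volume a b :=
    MonotoneOn.intervalIntegrable (by rwa [uIcc_of_le hle])
  obtain ⟨KH, hHL⟩ := exists_lipschitzOnWith_integral hρint fun x hx => by
    rw [Real.norm_of_nonneg (hρ0 x hx)]
    exact hC x hx
  have hgx : ∀ x ∈ Icc a b, g x = x * Real.exp (h a + ∫ t in a..x, ρ t) := fun x hx => by
    rw [hg x hx, hprim x hx]
  have hg0 : ∀ x ∈ Icc a b, 0 < g x := fun x hx => by
    rw [hg x hx]
    exact mul_pos (ha.trans_le hx.1) (Real.exp_pos _)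
  obtain ⟨Kg, hgL⟩ : ∃ K, LipschitzOnWith K g (Icc a b) := by
    obtain ⟨K, hK⟩ := (LipschitzWith.id.lipschitzOnWith.prodMk hHL).exists_comp_of_contDiffAt
      isCompact_Icc (φ := fun p : ℝ × ℝ => p.1 * Real.exp (h a + p.2)) fun x _ => by fun_prop
    refine ⟨K, fun x hx y hy => ?_⟩
    rw [hgx x hx, hgx y hy]
    exact hK hx hy
  have hgd : ∀ᵐ x, x ∈ Ioo a b → HasDerivAt g ((1 / x + ρ x) * g x) x := by
    filter_upwards [hρint.ae_hasDerivAt_integral_left hle] with x hH hx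
    have hxI := Ioo_subset_Icc_self hx
    have hx0 : x ≠ 0 := (ha.trans hx.1).ne'
    refine (((hasDerivAt_id x).mul ((hH hx).const_add (h a)).exp).congr_of_eventuallyEq
      (eventually_of_mem (Icc_mem_nhds hx.1 hx.2) hgx)).congr_deriv ?_
    rw [hgx x hxI]
    simp only [id]
    field_simp
  have hsol : ∀ w lam, IsRiccatiSol a b lam ρ w →
      ∀ x ∈ Icc a b, w x * (g a + lam * ∫ t in a..x, g t) = g x := by
    rintro w lam ⟨⟨K, hK⟩, hw, hwa, -⟩
    exact riccati_mul_eq hle hgL hg0 hgd hK hw hwa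
  have hGpos : 0 < ∫ t in a..b, g t :=
    intervalIntegral.intervalIntegral_pos_of_pos_on
      (hgL.continuousOn.intervalIntegrable_of_Icc hle)
      (fun x hx => hg0 x (Ioo_subset_Icc_self hx)) hab
  have hlam : ∀ w lam, IsRiccatiSol a b lam ρ w → lam = (g b - g a) / ∫ t in a..b, g t := by
    intro w lam hs
    have hb := hsol w lam hs b hbI
    rw [hs.2.2.2] at hb
    rw [eq_div_iff hGpos.ne']
    linear_combination hb
  refine ⟨?_, ?_, hlam⟩
  · have hgab : g a ≤ g b := by
      rw [hgx a haI, hgx b hbI, intervalIntegral.integral_same]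
      have := intervalIntegral.integral_nonneg (μ := volume) hle hρ0
      have := ha.le.trans hle
      gcongr
    have hD : ∀ x ∈ Icc a b,
        0 < g a + (g b - g a) / (∫ t in a..b, g t) * ∫ t in a..x, g t := fun x hx =>
      add_pos_of_pos_of_nonneg (hg0 a haI) (mul_nonneg
        (div_nonneg (sub_nonneg.2 hgab) hGpos.le)
        (intervalIntegral.integral_nonneg hx.1 fun t ht => (hg0 t ⟨ht.1, ht.2.trans hx.2⟩).le))
    obtain ⟨hL, hd⟩ := riccati_div_solves hle hgL hgd hD
    refine ⟨_, _, hL, hd, ?_, ?_⟩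
    · simp [(hg0 a haI).ne']
    · rw [div_mul_cancel₀ _ hGpos.ne', add_sub_cancel, div_self (hg0 b hbI).ne']
  · intro w₁ lam₁ w₂ lam₂ h₁ h₂
    have hl : lam₁ = lam₂ := (hlam _ _ h₁).trans (hlam _ _ h₂).symm
    refine ⟨hl, fun x hx => ?_⟩
    have e₁ := hsol _ _ h₁ x hx
    have e₂ := hsol _ _ h₂ x hx
    subst hl
    refine mul_right_cancel₀ (fun h0 => ?_) (e₁.trans e₂.symm)
    rw [h0, mul_zero] at e₁
    exact (hg0 x hx).ne e₁
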